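/- Let tₙ → ∞ be a sequence of real numbers and ψ : ℝ → ℝ a function such that the translates φ(· + tₙ) converge to ψ uniformly on compact subsets of ℝ. If ψ is not identically zero, then ψ is not Bohr almost periodic. -/

import Mathlib

open Filter

def BohrAP (h : ℝ → ℝ) : Prop :=
  Continuous h ∧ ∀ ε > (0:ℝ), ∃ L > (0:ℝ), ∀ s : ℝ,
    ∃ τ ∈ Set.Icc s (s + L), ∀ t : ℝ, |h (t + τ) - h t| ≤ ε

noncomputable def phiAP (t : ℝ) : ℝ :=
  Real.exp (∑' k : ℕ, (Real.cos ((1 / 2 ^ (k + 1) : ℝ) * Real.pi * t) - 1))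

lemma cosdiff (a b : ℝ) : |Real.cos a - Real.cos b| ≤ |a - b| := by
  have := Real.lipschitzWith_cos.dist_le_mul a b
  simpa [Real.dist_eq] using this

noncomputable def wAP (k : ℕ) : ℝ := 1 / 2 ^ (k + 1) * Real.pi

lemma wAP_pos (k : ℕ) : 0 < wAP k := by unfold wAP; positivity

lemma wAP_succ (k : ℕ) : wAP k = 2 * wAP (k + 1) := by
  unfold wAP; field_simp; ring

lemma wAP_summable : Summable wAP := by
  unfold wAP
  apply Summable.mul_right
  have := (summable_nat_add_iff 1).2 summable_geometric_two
  simpa using this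

lemma phi_summable (t : ℝ) : Summable fun k : ℕ => (1 - Real.cos (wAP k * t)) := by
  refine Summable.of_nonneg_of_le (fun k => by linarith [Real.cos_le_one (wAP k * t)])
    (fun k => ?_) (wAP_summable.mul_right |t|)
  have := cosdiff 0 (wAP k * t)
  rw [Real.cos_zero, zero_sub, abs_neg, abs_mul, abs_of_pos (wAP_pos k)] at this
  exact (le_abs_self _).trans this

noncomputable def fAP (t : ℝ) : ℝ := ∑' k : ℕ, (1 - Real.cos (wAP k * t))

lemma phi_eq (t : ℝ) : phiAP t = Real.exp (- fAP t) := by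
  unfold phiAP fAP
  rw [← tsum_neg]
  congr 1
  apply tsum_congr
  intro k
  unfold wAP
  ring

lemma fAP_term_le (t : ℝ) (k : ℕ) : 1 - Real.cos (wAP k * t) ≤ fAP t :=
  (phi_summable t).le_tsum k (fun j _ => by linarith [Real.cos_le_one (wAP j * t)])

lemma fAP_sum_le (t : ℝ) (N : ℕ) :
    ∑ k ∈ Finset.range N, (1 - Real.cos (wAP k * t)) ≤ fAP t :=
  (phi_summable t).sum_le_tsum _ (fun j _ => by linarith [Real.cos_le_one (wAP j * t)])

lemma phi_zero : phiAP 0 = 1 := by simp [phiAP]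

lemma phi_small (n : ℕ) (τ : ℝ) (h1 : 2 ^ (n + 1) ≤ τ) (h2 : τ ≤ 2 ^ (n + 1) + 2 ^ n) :
    phiAP τ ≤ 1 / 2 := by
  have hpi := Real.pi_pos
  have hw : wAP n * 2 ^ (n + 1) = Real.pi := by unfold wAP; field_simp
  have hw' : wAP n * 2 ^ n = Real.pi / 2 := by
    rw [← hw, pow_succ]; ring
  have h3 : Real.pi ≤ wAP n * τ := by
    rw [← hw]; exact mul_le_mul_of_nonneg_left h1 (wAP_pos n).le
  have h4 : wAP n * τ ≤ Real.pi + Real.pi / 2 := by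
    rw [← hw', ← hw, ← mul_add]; exact mul_le_mul_of_nonneg_left h2 (wAP_pos n).le
  have hc := Real.cos_nonpos_of_pi_div_two_le_of_le (by linarith : Real.pi / 2 ≤ wAP n * τ) h4
  have hf := fAP_term_le τ n
  rw [phi_eq, Real.exp_neg, one_div]
  apply inv_anti₀ (by norm_num)
  linarith [Real.add_one_le_exp (fAP τ)]

/-- if all angles tend to 0, increments converge. -/
lemma phi_ratio (U : Filter ℕ) (y : ℕ → ℝ)
    (hy : ∀ k, Tendsto (fun n => Circle.exp (wAP k * y n)) U (nhds 1)) (t : ℝ) :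
    Tendsto (fun n => fAP (t + y n) - fAP (y n)) U (nhds (fAP t)) := by
  have heq : ∀ n, fAP (t + y n) - fAP (y n)
      = ∑' k, (Real.cos (wAP k * y n) - Real.cos (wAP k * (t + y n))) := by
    intro n
    unfold fAP
    rw [← (phi_summable _).tsum_sub (phi_summable _)]
    apply tsum_congr
    intro k; ring
  simp_rw [heq]
  unfold fAP
  refine tendsto_tsum_of_dominated_convergence (bound := fun k => wAP k * |t|)
    (wAP_summable.mul_right |t|) ?_ ?_
  · intro k
    have hre : ∀ a : ℝ, Tendsto (fun n => Real.cos (a + wAP k * y n)) U (nhds (Real.cos a)) := by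
      intro a
      have h1 : Tendsto (fun n => ((Circle.exp a * Circle.exp (wAP k * y n) : Circle) : ℂ).re) U
          (nhds ((Circle.exp a * 1 : Circle) : ℂ).re) :=
        ((Complex.continuous_re.comp continuous_subtype_val).tendsto _).comp
          ((hy k).const_mul (Circle.exp a))
      simp_rw [← Circle.exp_add, mul_one, Circle.coe_exp, Complex.exp_ofReal_mul_I_re] at h1
      exact h1
    have h0 := hre 0
    have ht := hre (wAP k * t)
    simp only [zero_add, Real.cos_zero] at h0
    simp_rw [mul_add]
    exact h0.sub ht
  · refine Eventually.of_forall fun n k => ?_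
    rw [Real.norm_eq_abs]
    refine (cosdiff _ _).trans ?_
    rw [show wAP k * y n - wAP k * (t + y n) = - (wAP k * t) by ring, abs_neg, abs_mul,
      abs_of_pos (wAP_pos k)]

lemma find_shift (U : Ultrafilter ℕ) (x : ℕ → ℝ) (A : ℝ)
    (hA : ∀ᶠ n in (U : Filter ℕ), fAP (x n) ≤ A) :
    ∃ s : ℝ, ∀ k, Tendsto (fun n => Circle.exp (wAP k * (x n - s))) U (nhds 1) := by
  have hz : ∀ k, ∃ z : Circle, Tendsto (fun n => Circle.exp (wAP k * x n)) U (nhds z) := by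
    intro k
    obtain ⟨z, -, hz⟩ := isCompact_univ.ultrafilter_le_nhds
      (U.map (fun n => Circle.exp (wAP k * x n))) (by simp)
    exact ⟨z, hz⟩
  choose z hz using hz
  have hsq : ∀ k, z (k + 1) * z (k + 1) = z k := by
    intro k
    refine tendsto_nhds_unique ((hz (k+1)).mul (hz (k+1))) ?_
    refine (hz k).congr fun n => ?_
    rw [← Circle.exp_add, wAP_succ k]; congr 1; ring
  have hre : ∀ k, Tendsto (fun n => 1 - Real.cos (wAP k * x n)) U (nhds (1 - (z k : ℂ).re)) := by
    intro k
    have h1 : Tendsto (fun n => ((Circle.exp (wAP k * x n) : Circle) : ℂ).re) U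
          (nhds (z k : ℂ).re) :=
        ((Complex.continuous_re.comp continuous_subtype_val).tendsto _).comp (hz k)
    simp_rw [Circle.coe_exp, Complex.exp_ofReal_mul_I_re] at h1
    exact h1.const_sub 1
  have hsum : Summable fun k => 1 - (z k : ℂ).re := by
    refine summable_of_sum_range_le (c := A) ?_ ?_
    · intro k
      exact ge_of_tendsto (hre k) (Eventually.of_forall fun n => by
        linarith [Real.cos_le_one (wAP k * x n)])
    · intro N
      refine le_of_tendsto (tendsto_finsetSum (Finset.range N) fun k _ => hre k) ?_
      filter_upwards [hA] with n hn
      exact (fAP_sum_le _ _).trans hn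
  have hlim : Tendsto (fun k => (z k : ℂ).re) atTop (nhds 1) := by
    have := hsum.tendsto_atTop_zero.const_sub 1
    simpa using this
  have hev : ∀ᶠ k in atTop, 0 < (z k : ℂ).re := hlim.eventually (lt_mem_nhds one_pos)
  obtain ⟨K, hK⟩ := eventually_atTop.1 hev
  have hpi := Real.pi_pos
  have harg : ∀ k ≥ K, Complex.arg (z k) = 2 * Complex.arg (z (k + 1)) := by
    intro k hk
    have h1 := Complex.abs_arg_lt_pi_div_two_iff.2 (Or.inl (hK (k+1) (by omega)))
    rw [abs_lt] at h1
    rw [← hsq k]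
    conv_lhs => rw [← Circle.exp_arg (z (k+1)), ← Circle.exp_add]
    rw [Circle.arg_exp (by linarith) (by linarith)]
    ring
  have hcl : ∀ j, z (K + j) = Circle.exp (wAP (K + j) * (Complex.arg (z K) / wAP K)) := by
    have : ∀ j, Complex.arg (z (K + j)) = wAP (K + j) * (Complex.arg (z K) / wAP K) := by
      intro j
      induction j with
      | zero => have := (wAP_pos K).ne'; simp; field_simp
      | succ j ih =>
        have h1 := harg (K + j) (by omega)
        rw [ih, wAP_succ (K + j)] at h1
        rw [← add_assoc]
        linarith
    intro j
    rw [← this j, Circle.exp_arg]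
  set s := Complex.arg (z K) / wAP K with hs
  have hdown : ∀ j k, z (k + j) = Circle.exp (wAP (k + j) * s) → z k = Circle.exp (wAP k * s) := by
    intro j
    induction j with
    | zero => intro k h; exact h
    | succ j ih =>
      intro k h
      apply ih
      rw [← hsq (k + j), add_assoc, h, ← Circle.exp_add, wAP_succ (k + j)]
      congr 1
      rw [add_assoc]; ring
  refine ⟨s, fun k => ?_⟩
  have hk : z k = Circle.exp (wAP k * s) := hdown K k (by rw [add_comm k K]; exact hcl k)
  have h := (hz k).div_const (z k)
  rw [div_self'] at h
  refine h.congr fun n => ?_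
  rw [hk, ← Circle.exp_sub, mul_sub]

theorem stmt19 (tn : ℕ → ℝ) (htn : Tendsto tn atTop atTop)
    (ψ : ℝ → ℝ)
    (hconv : ∀ K : Set ℝ, IsCompact K →
      TendstoUniformlyOn (fun (n : ℕ) (t : ℝ) => phiAP (t + tn n)) ψ atTop K)
    (hne : ∃ t : ℝ, ψ t ≠ 0) :
    ¬ BohrAP ψ := by
  rintro ⟨-, hap⟩
  obtain ⟨t0, ht0⟩ := hne
  obtain ⟨U, hU⟩ := Ultrafilter.exists_le (atTop : Filter ℕ)
  have hpt : ∀ t, Tendsto (fun n => phiAP (t + tn n)) U (nhds (ψ t)) := fun t =>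
    ((hconv {t} isCompact_singleton).tendsto_at (Set.mem_singleton t)).mono_left hU
  have hnn : ∀ t, 0 ≤ ψ t := fun t => ge_of_tendsto (hpt t)
    (Eventually.of_forall fun n => (Real.exp_pos _).le)
  have hpos : 0 < ψ t0 := lt_of_le_of_ne (hnn t0) ht0.symm
  have hA : ∀ᶠ n in (U : Filter ℕ), fAP (t0 + tn n) ≤ - Real.log (ψ t0 / 2) := by
    filter_upwards [(hpt t0).eventually (lt_mem_nhds (half_lt_self hpos))] with n hn
    rw [phi_eq] at hn
    have := (Real.log_lt_iff_lt_exp (half_pos hpos)).2 hn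
    linarith
  obtain ⟨s, hs⟩ := find_shift U (fun n => t0 + tn n) _ hA
  have key : ∀ v, ψ (v + (t0 - s)) = ψ (t0 - s) * phiAP v := by
    intro v
    have h1 := phi_ratio U _ hs v
    have h2 := (Real.continuous_exp.tendsto _).comp h1.neg
    have h3 := (hpt (t0 - s)).mul h2
    rw [← phi_eq] at h3
    refine tendsto_nhds_unique (hpt _) (h3.congr fun n => ?_)
    simp only [Function.comp]
    rw [phi_eq, phi_eq, ← Real.exp_add]
    congr 1
    rw [show t0 - s + tn n = t0 + tn n - s by ring,
      show v + (t0 - s) + tn n = v + (t0 + tn n - s) by ring]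
    ring
  have hc : 0 < ψ (t0 - s) := by
    refine lt_of_le_of_ne (hnn _) fun h => ht0 ?_
    have := key s
    rw [← h] at this
    simpa using this
  obtain ⟨L, hL, hτ⟩ := hap (ψ (t0 - s) / 4) (by positivity)
  obtain ⟨n, hn⟩ := pow_unbounded_of_one_lt L (one_lt_two)
  obtain ⟨τ, ⟨h1, h2⟩, h3⟩ := hτ (2 ^ (n + 1))
  have hsm := phi_small n τ h1 (by linarith)
  have h4 := h3 (t0 - s)
  rw [add_comm, key τ, abs_le] at h4
  nlinarith [h4.1, mul_le_mul_of_nonneg_left hsm hc.le]
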